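/- arXiv:2401.15801 — 2 statements merged into one kernel-verified Lean document; each statement's English description precedes it below -/
import Mathlib

section
/- Let β > 0 and d ∈ ℕ with d ≥ 2β, let d⋆ ∈ [2β, d], and let 0 < s < d⋆. Consider the class M^{d⋆,β} of all Borel probability measures μ on [0,1]^d whose β-upper Wasserstein dimension satisfies d*_β(μ) ≤ d⋆. Then there exist c > 0 and n₀ ∈ ℕ such that for every n ≥ n₀ and every estimator — every map μ̂ from ([0,1]^d)^n to Borel probability measures on [0,1]^d, measurable with respect to the Borel σ-algebra of the weak topology — one has sup_{μ ∈ M^{d⋆,β}} E_{X_1,…,X_n i.i.d. μ} ‖μ̂(X_1,…,X_n) − μ‖_{H^β(ℝ^d,ℝ,1)} ≥ c n^{-β/s}. -/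
open Filter Topology MeasureTheory Set
open scoped ENNReal NNReal

noncomputable section

/-- Minimal number of closed balls of radius `ε` needed to cover `S`. -/
def coverN {X : Type*} [PseudoMetricSpace X] (ε : ℝ) (S : Set X) : ℕ∞ :=
  ⨅ (t : Finset X) (_ : S ⊆ ⋃ x ∈ t, Metric.closedBall x ε), (t.card : ℕ∞)

/-- The `(ε,τ)`-covering number of a measure `μ`. -/
def measCoverN {X : Type*} [PseudoMetricSpace X] [MeasurableSpace X]
    (μ : Measure X) (ε τ : ℝ) : ℕ∞ :=
  ⨅ (S : Set X) (_ : MeasurableSet S) (_ : ENNReal.ofReal (1 - τ) ≤ μ S), coverN ε S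

/-- Extended logarithm `ℝ≥0∞ → EReal`. -/
def elog (x : ℝ≥0∞) : EReal :=
  if x = 0 then ⊥ else if x = ⊤ then ⊤ else ((Real.log x.toReal : ℝ) : EReal)

/-- `log N / log (1/ε)` as an extended real. -/
def dimRatio (N : ℕ∞) (ε : ℝ) : EReal :=
  elog (N : ℝ≥0∞) * (((Real.log (1 / ε))⁻¹ : ℝ) : EReal)

/-- The `α`-entropic dimension of a measure. -/
def entropicDim {X : Type*} [PseudoMetricSpace X] [MeasurableSpace X]
    (μ : Measure X) (α : ℝ) : EReal :=
  limsup (fun ε : ℝ => dimRatio (measCoverN μ ε (ε ^ α)) ε) (𝓝[>] (0 : ℝ))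

/-- The `α`-upper Wasserstein dimension of a measure. -/
def upperWDim {X : Type*} [PseudoMetricSpace X] [MeasurableSpace X]
    (μ : Measure X) (α : ℝ) : EReal :=
  sInf {x : EReal | ∃ s : ℝ, x = (s : EReal) ∧ 2 * α < s ∧
    limsup (fun ε : ℝ => dimRatio (measCoverN μ ε (ε ^ (s * α / (s - 2 * α)))) ε)
      (𝓝[>] (0 : ℝ)) ≤ (s : EReal)}

/-- The lower Wasserstein dimension of a measure. -/
def lowerWDim {X : Type*} [PseudoMetricSpace X] [MeasurableSpace X]
    (μ : Measure X) : EReal :=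
  limsup (fun τ : ℝ =>
    liminf (fun ε : ℝ => dimRatio (measCoverN μ ε τ) ε) (𝓝[>] (0 : ℝ))) (𝓝[>] (0 : ℝ))

/-- The support of a measure: points all of whose neighbourhoods have positive mass. -/
def msupport {X : Type*} [PseudoMetricSpace X] [MeasurableSpace X] (μ : Measure X) : Set X :=
  {x | ∀ r : ℝ, 0 < r → 0 < μ (Metric.ball x r)}

/-- The upper Minkowski dimension of (the support of) a measure. -/
def minkowskiDim {X : Type*} [PseudoMetricSpace X] [MeasurableSpace X]
    (μ : Measure X) : EReal :=
  limsup (fun ε : ℝ => dimRatio (coverN ε (msupport μ)) ε) (𝓝[>] (0 : ℝ))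

/-- The upper packing dimension of a measure. -/
def packingDim {X : Type*} [PseudoMetricSpace X] [MeasurableSpace X]
    (μ : Measure X) : EReal :=
  essSup (fun x =>
    limsup (fun r : ℝ => elog (μ (Metric.closedBall x r)) * (((Real.log r)⁻¹ : ℝ) : EReal))
      (𝓝[>] (0 : ℝ))) μ

/-- The lower regularity dimension of a measure. -/
def lowerRegDim {X : Type*} [PseudoMetricSpace X] [MeasurableSpace X]
    (μ : Measure X) : EReal :=
  sSup {x : EReal | ∃ s : ℝ, x = (s : EReal) ∧ ∃ C : ℝ, 0 < C ∧
    ∀ x0 ∈ msupport μ, ∀ r R : ℝ, 0 < r → r < R →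
      ENNReal.ofReal (C * (R / r) ^ s) ≤
        μ (Metric.closedBall x0 R) / μ (Metric.closedBall x0 r)}

/-- Partial derivative in coordinate `i`. -/
def pderiv' {d : ℕ} (i : Fin d) (f : (Fin d → ℝ) → ℝ) : (Fin d → ℝ) → ℝ :=
  fun x => fderiv ℝ f x (Pi.single i 1)

/-- Multi-index partial derivative `∂^s f`. -/
def mpderiv {d : ℕ} (s : Fin d → ℕ) (f : (Fin d → ℝ) → ℝ) : (Fin d → ℝ) → ℝ :=
  (List.finRange d).foldr (fun i g => (pderiv' i)^[s i] g) f

/-- The `β`-Hölder norm of `f : ℝ^d → ℝ` (with `ℓ∞` distances), valued in `ℝ≥0∞`. -/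
def holderNorm {d : ℕ} (β : ℝ) (f : (Fin d → ℝ) → ℝ) : ℝ≥0∞ :=
  (∑' s : {s : Fin d → ℕ // ∑ i, s i ≤ ⌊β⌋₊}, ⨆ x : Fin d → ℝ, (‖mpderiv s.1 f x‖₊ : ℝ≥0∞)) +
  ∑' s : {s : Fin d → ℕ // ∑ i, s i = ⌊β⌋₊}, ⨆ (x : Fin d → ℝ) (y : Fin d → ℝ) (_ : x ≠ y),
      (‖mpderiv s.1 f x - mpderiv s.1 f y‖₊ : ℝ≥0∞) / (nndist x y : ℝ≥0∞) ^ (β - (⌊β⌋₊ : ℝ))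

/-- The class `H^β(ℝ^d, ℝ, C)` of `β`-Hölder functions with norm at most `C`. -/
def HolderClass (d : ℕ) (β C : ℝ) : Set ((Fin d → ℝ) → ℝ) :=
  {f | ContDiff ℝ (⌊β⌋₊ : ℕ) f ∧ holderNorm β f ≤ ENNReal.ofReal C}

/-- The integral probability metric `‖P - Q‖_F`. -/
def ipm {X : Type*} [MeasurableSpace X] (F : Set (X → ℝ)) (P Q : Measure X) : ℝ :=
  ⨆ f : F, |∫ x, f.1 x ∂P - ∫ x, f.1 x ∂Q|

/-- The empirical measure of a sample `x : Fin n → X`. -/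
def empMeas {X : Type*} [MeasurableSpace X] {n : ℕ} (x : Fin n → X) : Measure X :=
  (n : ℝ≥0∞)⁻¹ • ∑ i : Fin n, Measure.dirac (x i)

/-- Total variation distance between two measures. -/
def tvDist {X : Type*} [MeasurableSpace X] (P Q : Measure X) : ℝ :=
  ⨆ A : {A : Set X // MeasurableSet A}, |(P A.1).toReal - (Q A.1).toReal|

end

open Filter Topology MeasureTheory Set
open scoped ENNReal

open scoped ContDiff

theorem ContDiff.pderiv' {d : ℕ} {f : (Fin d → ℝ) → ℝ} (hf : ContDiff ℝ ∞ f) (i : Fin d) :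
    ContDiff ℝ ∞ (pderiv' i f) :=
  (hf.fderiv_right (m := ∞) (by simp)).clm_apply contDiff_const

theorem tsupport_pderiv'_subset {d : ℕ} (f : (Fin d → ℝ) → ℝ) (i : Fin d) :
    tsupport (pderiv' i f) ⊆ tsupport f := by
  refine closure_minimal (fun x hx => ?_) (isClosed_tsupport f)
  refine support_fderiv_subset ℝ fun h => hx ?_
  simp [pderiv', h]

/-- Induction principle for multi-index derivatives of two functions taken in parallel. -/
theorem mpderiv_induction₂ {d : ℕ} {P : ℕ → ((Fin d → ℝ) → ℝ) → ((Fin d → ℝ) → ℝ) → Prop}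
    (step : ∀ k i f g, P k f g → P (k + 1) (pderiv' i f) (pderiv' i g))
    {f g : (Fin d → ℝ) → ℝ} (h0 : P 0 f g) (s : Fin d → ℕ) :
    P (∑ i, s i) (mpderiv s f) (mpderiv s g) := by
  have iter : ∀ (r k : ℕ) (i : Fin d) (f g : (Fin d → ℝ) → ℝ), P k f g →
      P (r + k) ((pderiv' i)^[r] f) ((pderiv' i)^[r] g) := by
    intro r
    induction r with
    | zero => intro k i f g h; simpa using h
    | succ r ih =>
      intro k i f g h
      rw [Function.iterate_succ_apply', Function.iterate_succ_apply', add_right_comm]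
      exact step _ _ _ _ (ih k i f g h)
  have fold : ∀ l : List (Fin d), P ((l.map s).sum)
      (l.foldr (fun i g => (pderiv' i)^[s i] g) f)
      (l.foldr (fun i g => (pderiv' i)^[s i] g) g) := by
    intro l
    induction l with
    | nil => simpa using h0
    | cons i l ih => simpa using iter (s i) _ i _ _ ih
  have := fold (List.finRange d)
  rwa [← List.ofFn_eq_map, List.sum_ofFn] at this

/-- A linear combination of translates of `g ∘ (c • ·)`. -/
def latticeComb {d : ℕ} {ι : Type*} [Fintype ι] (c : ℝ) (z : ι → Fin d → ℝ) (w : ι → ℝ)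
    (g : (Fin d → ℝ) → ℝ) (x : Fin d → ℝ) : ℝ :=
  ∑ j, w j * g (c • x - z j)

theorem ContDiff.latticeComb {d : ℕ} {ι : Type*} [Fintype ι] {c : ℝ} {z : ι → Fin d → ℝ}
    {w : ι → ℝ} {g : (Fin d → ℝ) → ℝ} {n : WithTop ℕ∞} (hg : ContDiff ℝ n g) :
    ContDiff ℝ n (latticeComb c z w g) :=
  ContDiff.sum fun _ _ => contDiff_const.mul
    (hg.comp ((contDiff_id.const_smul c).sub contDiff_const))

theorem pderiv'_latticeComb {d : ℕ} {ι : Type*} [Fintype ι] (c : ℝ) (z : ι → Fin d → ℝ)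
    (w : ι → ℝ) {g : (Fin d → ℝ) → ℝ} (hg : ContDiff ℝ ∞ g) (i : Fin d) :
    pderiv' i (latticeComb c z w g) = latticeComb c z (fun j => c * w j) (pderiv' i g) := by
  funext x
  have hd : Differentiable ℝ g := hg.differentiable (by simp)
  have h1 : ∀ j, HasFDerivAt (fun x : Fin d → ℝ => w j * g (c • x - z j))
      (w j • (fderiv ℝ g (c • x - z j)).comp (c • ContinuousLinearMap.id ℝ (Fin d → ℝ))) x :=
    fun j => ((hd _).hasFDerivAt.comp x
      (((hasFDerivAt_id x).const_smul c).sub_const (z j))).const_mul (w j)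
  have h2 := HasFDerivAt.fun_sum (u := Finset.univ) fun j _ => h1 j
  have h3 : fderiv ℝ (latticeComb c z w g) x = _ := h2.fderiv
  simp only [pderiv', latticeComb, h3, _root_.sum_apply]
  refine Finset.sum_congr rfl fun j _ => ?_
  simp
  ring

theorem mpderiv_latticeComb {d : ℕ} {ι : Type*} [Fintype ι] (c : ℝ) (z : ι → Fin d → ℝ)
    (w : ι → ℝ) {g : (Fin d → ℝ) → ℝ} (hg : ContDiff ℝ ∞ g) (s : Fin d → ℕ) :
    mpderiv s (latticeComb c z w g)
      = latticeComb c z (fun j => c ^ (∑ i, s i) * w j) (mpderiv s g) := by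
  refine (mpderiv_induction₂ (P := fun k f g => ContDiff ℝ ∞ g ∧
    f = latticeComb c z (fun j => c ^ k * w j) g) ?_ ⟨hg, by simp⟩ s).2
  rintro k i f g ⟨hg, rfl⟩
  refine ⟨hg.pderiv' i, ?_⟩
  rw [pderiv'_latticeComb _ _ _ hg]
  simp only [pow_succ', mul_assoc]

theorem ContDiff.mpderiv {d : ℕ} {g : (Fin d → ℝ) → ℝ} (hg : ContDiff ℝ ∞ g) (s : Fin d → ℕ) :
    ContDiff ℝ ∞ (mpderiv s g) :=
  mpderiv_induction₂ (P := fun _ _ g => ContDiff ℝ ∞ g) (fun _ i _ _ h => h.pderiv' i)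
    (f := g) hg s

theorem tsupport_mpderiv_subset {d : ℕ} (g : (Fin d → ℝ) → ℝ) (s : Fin d → ℕ) :
    tsupport (mpderiv s g) ⊆ tsupport g :=
  mpderiv_induction₂ (P := fun _ _ f => tsupport f ⊆ tsupport g)
    (fun _ i _ f h => (tsupport_pderiv'_subset f i).trans h) (f := g) subset_rfl s

/-- Smooth compactly supported functions are bounded and `γ`-Hölder for every `γ ∈ [0, 1]`. -/
theorem exists_bound_holder {E : Type*} [NormedAddCommGroup E] [NormedSpace ℝ E] {g : E → ℝ}
    (hg : ContDiff ℝ ∞ g) (hc : HasCompactSupport g) {γ : ℝ} (hγ0 : 0 ≤ γ) (hγ1 : γ ≤ 1) :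
    ∃ D : ℝ, 0 ≤ D ∧ (∀ u, |g u| ≤ D) ∧ ∀ u v, |g u - g v| ≤ D * ‖u - v‖ ^ γ := by
  obtain ⟨M, hM⟩ := hc.exists_bound_of_continuous hg.continuous
  obtain ⟨L, hL⟩ := ContDiff.lipschitzWith_of_hasCompactSupport hc hg (by simp)
  have hM0 : 0 ≤ M := (norm_nonneg _).trans (hM 0)
  refine ⟨2 * M + L, by positivity, fun u => ?_, fun u v => ?_⟩
  · have := hM u
    rw [Real.norm_eq_abs] at this
    linarith [L.coe_nonneg]
  · have hu := hM u
    have hv := hM v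
    rw [Real.norm_eq_abs] at hu hv
    have hlip := hL.dist_le_mul u v
    rw [Real.dist_eq, dist_eq_norm] at hlip
    have hγ : 0 ≤ ‖u - v‖ ^ γ := by positivity
    rcases le_total ‖u - v‖ 1 with h | h
    · have h1 : ‖u - v‖ ≤ ‖u - v‖ ^ γ := by
        simpa using Real.rpow_le_rpow_of_exponent_ge_of_imp (norm_nonneg (u - v)) h hγ1
          (fun _ h => absurd h one_ne_zero)
      calc |g u - g v| ≤ L * ‖u - v‖ := hlip
        _ ≤ L * ‖u - v‖ ^ γ := by gcongr
        _ ≤ _ := by nlinarith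
    · have h1 : 1 ≤ ‖u - v‖ ^ γ := Real.one_le_rpow h hγ0
      have := abs_sub (g u) (g v)
      nlinarith [L.coe_nonneg]

theorem card_filter_near_le_one {E ι : Type*} [SeminormedAddCommGroup E] [Fintype ι] {z : ι → E}
    (hz : Pairwise fun i j => 1 ≤ ‖z i - z j‖) (u : E) [DecidablePred fun j => ‖u - z j‖ ≤ 1 / 4] :
    (Finset.univ.filter fun j => ‖u - z j‖ ≤ 1 / 4).card ≤ 1 := by
  refine Finset.card_le_one.2 fun i hi j hj => by_contra fun hij => ?_
  simp only [Finset.mem_filter, Finset.mem_univ, true_and] at hi hj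
  have h1 := hz hij
  have h2 := norm_sub_le_norm_sub_add_norm_sub (z i) u (z j)
  rw [norm_sub_rev (z i) u] at h2
  linarith

theorem eq_zero_of_tsupport_subset_ball {E : Type*} [SeminormedAddCommGroup E] {g : E → ℝ}
    {r : ℝ} (hs : tsupport g ⊆ Metric.closedBall 0 r) {u : E} (hu : ¬ ‖u‖ ≤ r) : g u = 0 :=
  image_eq_zero_of_notMem_tsupport fun h => hu (by simpa using hs h)

theorem abs_latticeComb_le {d : ℕ} {ι : Type*} [Fintype ι] {c : ℝ} {z : ι → Fin d → ℝ}
    (hz : Pairwise fun i j => 1 ≤ ‖z i - z j‖) {w : ι → ℝ} {W D : ℝ} (hw : ∀ j, |w j| ≤ W)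
    (hW : 0 ≤ W) {g : (Fin d → ℝ) → ℝ} (hs : tsupport g ⊆ Metric.closedBall 0 (1 / 4))
    (hD : ∀ u, |g u| ≤ D) (x : Fin d → ℝ) :
    |latticeComb c z w g x| ≤ W * D := by
  classical
  have hD0 : 0 ≤ D := (abs_nonneg _).trans (hD 0)
  have hcard := card_filter_near_le_one hz (c • x)
  set S := Finset.univ.filter fun j => ‖c • x - z j‖ ≤ 1 / 4 with hS
  have hsum : latticeComb c z w g x = ∑ j ∈ S, w j * g (c • x - z j) := by
    refine (Finset.sum_subset (Finset.subset_univ _) fun j _ hj => ?_).symm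
    rw [eq_zero_of_tsupport_subset_ball hs (by simpa [hS] using hj), mul_zero]
  rw [hsum]
  calc |∑ j ∈ S, w j * g (c • x - z j)| ≤ ∑ j ∈ S, |w j * g (c • x - z j)| :=
        Finset.abs_sum_le_sum_abs _ _
    _ ≤ S.card • (W * D) := Finset.sum_le_card_nsmul _ _ _ fun j _ => by
        rw [abs_mul]; exact mul_le_mul (hw j) (hD _) (abs_nonneg _) hW
    _ ≤ 1 • (W * D) := by gcongr
    _ = W * D := one_smul _ _

theorem abs_latticeComb_sub_le {d : ℕ} {ι : Type*} [Fintype ι] {c : ℝ} (hc : 0 ≤ c)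
    {z : ι → Fin d → ℝ} (hz : Pairwise fun i j => 1 ≤ ‖z i - z j‖) {w : ι → ℝ} {W D γ : ℝ}
    (hw : ∀ j, |w j| ≤ W) (hW : 0 ≤ W) (hD0 : 0 ≤ D) {g : (Fin d → ℝ) → ℝ}
    (hs : tsupport g ⊆ Metric.closedBall 0 (1 / 4))
    (hD : ∀ u v, |g u - g v| ≤ D * ‖u - v‖ ^ γ) (x y : Fin d → ℝ) :
    |latticeComb c z w g x - latticeComb c z w g y| ≤ 2 * (W * D * (c ^ γ * ‖x - y‖ ^ γ)) := by
  classical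
  have hcx := card_filter_near_le_one hz (c • x)
  have hcy := card_filter_near_le_one hz (c • y)
  set S := (Finset.univ.filter fun j => ‖c • x - z j‖ ≤ 1 / 4) ∪
    (Finset.univ.filter fun j => ‖c • y - z j‖ ≤ 1 / 4) with hS
  have hcard : S.card ≤ 2 := (Finset.card_union_le _ _).trans (by omega)
  have hsum : latticeComb c z w g x - latticeComb c z w g y
      = ∑ j ∈ S, w j * (g (c • x - z j) - g (c • y - z j)) := by
    simp only [latticeComb, ← Finset.sum_sub_distrib, ← mul_sub]
    refine (Finset.sum_subset (Finset.subset_univ _) fun j _ hj => ?_).symm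
    simp only [hS, Finset.mem_union, Finset.mem_filter, Finset.mem_univ, true_and, not_or] at hj
    rw [eq_zero_of_tsupport_subset_ball hs hj.1, eq_zero_of_tsupport_subset_ball hs hj.2]
    simp
  rw [hsum]
  calc |∑ j ∈ S, w j * (g (c • x - z j) - g (c • y - z j))|
      ≤ ∑ j ∈ S, |w j * (g (c • x - z j) - g (c • y - z j))| := Finset.abs_sum_le_sum_abs _ _
    _ ≤ S.card • (W * D * (c ^ γ * ‖x - y‖ ^ γ)) := Finset.sum_le_card_nsmul _ _ _ fun j _ => by
        rw [abs_mul, mul_assoc W]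
        refine mul_le_mul (hw j) ((hD _ _).trans_eq ?_) (abs_nonneg _) hW
        rw [sub_sub_sub_cancel_right, ← smul_sub, norm_smul, Real.norm_of_nonneg hc,
          Real.mul_rpow hc (norm_nonneg _)]
    _ ≤ 2 • (W * D * (c ^ γ * ‖x - y‖ ^ γ)) := by gcongr
    _ = _ := by rw [nsmul_eq_mul]; simp

instance finite_multiIndex_le (d b : ℕ) : Finite {s : Fin d → ℕ // ∑ i, s i ≤ b} :=
  Set.Finite.to_subtype <| (Set.finite_Iic fun _ => b).subset fun s hs i =>
    (Finset.single_le_sum (f := s) (fun _ _ => Nat.zero_le _) (Finset.mem_univ i)).trans hs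

instance finite_multiIndex_eq (d b : ℕ) : Finite {s : Fin d → ℕ // ∑ i, s i = b} :=
  Finite.of_injective (fun s => (⟨s.1, s.2.le⟩ : {s : Fin d → ℕ // ∑ i, s i ≤ b}))
    fun _ _ h => Subtype.ext (congrArg (fun s => s.1) h)

/-- Small multiples of sums of disjoint rescaled bumps lie in the Hölder unit ball. -/
theorem exists_latticeComb_mem_holderClass {d : ℕ} {β : ℝ} (hβ : 0 < β) {g : (Fin d → ℝ) → ℝ}
    (hg : ContDiff ℝ ∞ g) (hs : tsupport g ⊆ Metric.closedBall 0 (1 / 4)) :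
    ∃ A > (0 : ℝ), ∀ (ι : Type) [Fintype ι] (c : ℝ), 1 ≤ c → ∀ (z : ι → Fin d → ℝ) (w : ι → ℝ),
      (Pairwise fun i j => 1 ≤ ‖z i - z j‖) → (∀ j, |w j| ≤ A * c ^ (-β)) →
        latticeComb c z w g ∈ HolderClass d β 1 := by
  have hb : (⌊β⌋₊ : ℝ) ≤ β := Nat.floor_le hβ.le
  have hb1 : β - ⌊β⌋₊ ≤ 1 := by linarith [Nat.lt_floor_add_one β]
  have hcs : ∀ s : Fin d → ℕ, HasCompactSupport (mpderiv s g) := fun s =>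
    (isCompact_closedBall (0 : Fin d → ℝ) (1 / 4)).of_isClosed_subset (isClosed_tsupport _)
      ((tsupport_mpderiv_subset g s).trans hs)
  choose D hD0 hD hDγ using fun s : Fin d → ℕ =>
    exists_bound_holder (hg.mpderiv s) (hcs s) (sub_nonneg.2 hb) hb1
  have := Fintype.ofFinite {s : Fin d → ℕ // ∑ i, s i ≤ ⌊β⌋₊}
  have := Fintype.ofFinite {s : Fin d → ℕ // ∑ i, s i = ⌊β⌋₊}
  set T : ℝ := ∑ s : {s : Fin d → ℕ // ∑ i, s i ≤ ⌊β⌋₊}, D s +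
    ∑ s : {s : Fin d → ℕ // ∑ i, s i = ⌊β⌋₊}, 2 * D s with hT
  have hT0 : 0 ≤ T := add_nonneg (Finset.sum_nonneg fun s _ => hD0 _)
    (Finset.sum_nonneg fun s _ => mul_nonneg zero_le_two (hD0 _))
  refine ⟨(T + 1)⁻¹, by positivity, fun ι _ c hc z w hz hw => ⟨hg.latticeComb.of_le ?_, ?_⟩⟩
  · exact_mod_cast le_top
  set A : ℝ := (T + 1)⁻¹ with hA
  have hA0 : 0 < A := by positivity
  have hc0 : 0 < c := by linarith
  have hw' : ∀ s : Fin d → ℕ, ∀ j, |c ^ (∑ i, s i) * w j| ≤ A * c ^ ((∑ i, s i : ℕ) - β) := by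
    intro s j
    rw [abs_mul, abs_of_pos (by positivity), sub_eq_add_neg, Real.rpow_add hc0, Real.rpow_natCast]
    calc _ ≤ c ^ (∑ i, s i) * (A * c ^ (-β)) := by gcongr; exact hw j
      _ = _ := by ring
  have h1 : ∀ s : {s : Fin d → ℕ // ∑ i, s i ≤ ⌊β⌋₊},
      ⨆ x : Fin d → ℝ, (‖mpderiv s.1 (latticeComb c z w g) x‖₊ : ℝ≥0∞)
        ≤ ENNReal.ofReal (A * D s) := by
    refine fun s => iSup_le fun x => ?_
    rw [← enorm_eq_nnnorm, Real.enorm_eq_ofReal_abs]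
    refine ENNReal.ofReal_le_ofReal ?_
    rw [mpderiv_latticeComb c z w hg]
    refine abs_latticeComb_le hz (fun j => (hw' s j).trans ?_) hA0.le
      ((tsupport_mpderiv_subset g s).trans hs) (hD s) x
    have hle : ((∑ i, s.1 i : ℕ) : ℝ) ≤ ⌊β⌋₊ := by exact_mod_cast s.2
    exact mul_le_of_le_one_right hA0.le (Real.rpow_le_one_of_one_le_of_nonpos hc (by linarith))
  have h2 : ∀ s : {s : Fin d → ℕ // ∑ i, s i = ⌊β⌋₊},
      (⨆ (x : Fin d → ℝ) (y : Fin d → ℝ) (_ : x ≠ y),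
        (‖mpderiv s.1 (latticeComb c z w g) x - mpderiv s.1 (latticeComb c z w g) y‖₊ : ℝ≥0∞) /
          (nndist x y : ℝ≥0∞) ^ (β - (⌊β⌋₊ : ℝ))) ≤ ENNReal.ofReal (A * (2 * D s)) := by
    refine fun s => iSup_le fun x => iSup_le fun y => iSup_le fun hxy => ?_
    have hpos : 0 < ‖x - y‖ := norm_sub_pos_iff.2 hxy
    refine ENNReal.div_le_of_le_mul ?_
    rw [← enorm_eq_nnnorm, Real.enorm_eq_ofReal_abs, ← edist_nndist, edist_dist, dist_eq_norm,
      ENNReal.ofReal_rpow_of_pos hpos, ← ENNReal.ofReal_mul (mul_nonneg hA0.le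
        (mul_nonneg zero_le_two (hD0 _)))]
    refine ENNReal.ofReal_le_ofReal ?_
    rw [mpderiv_latticeComb c z w hg]
    refine (abs_latticeComb_sub_le hc0.le hz (hw' s) (by positivity) (hD0 s)
      ((tsupport_mpderiv_subset g s).trans hs) (hDγ s) x y).trans_eq ?_
    have hone : c ^ ((∑ i, s.1 i : ℕ) - β) * c ^ (β - ⌊β⌋₊) = 1 := by
      rw [← Real.rpow_add hc0, s.2]; simp
    linear_combination 2 * A * D s * ‖x - y‖ ^ (β - ⌊β⌋₊) * hone
  unfold holderNorm
  rw [tsum_fintype, tsum_fintype]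
  refine (add_le_add (Finset.sum_le_sum fun s _ => h1 s)
    (Finset.sum_le_sum fun s _ => h2 s)).trans ?_
  rw [← ENNReal.ofReal_sum_of_nonneg fun s _ => mul_nonneg hA0.le (hD0 _),
    ← ENNReal.ofReal_sum_of_nonneg fun s _ => mul_nonneg hA0.le (mul_nonneg zero_le_two (hD0 _)),
    ← ENNReal.ofReal_add (Finset.sum_nonneg fun s _ => mul_nonneg hA0.le (hD0 _))
      (Finset.sum_nonneg fun s _ => mul_nonneg hA0.le (mul_nonneg zero_le_two (hD0 _))),
    ← Finset.mul_sum, ← Finset.mul_sum, ← mul_add, ← hT]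
  refine ENNReal.ofReal_le_ofReal ?_
  rw [hA, inv_mul_le_iff₀ (by positivity)]
  linarith

theorem abs_le_of_mem_holderClass {d : ℕ} {β C : ℝ} (hC : 0 ≤ C) {f : (Fin d → ℝ) → ℝ}
    (hf : f ∈ HolderClass d β C) (x : Fin d → ℝ) : |f x| ≤ C := by
  have h0 : mpderiv (0 : Fin d → ℕ) f = f := by
    simp [mpderiv]
  have h1 : (‖f x‖₊ : ℝ≥0∞) ≤ holderNorm β f := by
    refine le_trans ?_ le_self_add
    refine le_trans ?_ (ENNReal.le_tsum (⟨0, by simp⟩ : {s : Fin d → ℕ // ∑ i, s i ≤ ⌊β⌋₊}))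
    rw [h0]
    exact le_iSup (fun x => (‖f x‖₊ : ℝ≥0∞)) x
  have h2 := h1.trans hf.2
  rwa [← enorm_eq_nnnorm, Real.enorm_eq_ofReal_abs, ENNReal.ofReal_le_ofReal_iff hC] at h2

theorem dimRatio_le_of_le {N : ℕ∞} {k : ℕ} (hN : N ≤ k) {ε s : ℝ} (hε : Real.log (1 / ε) > 0)
    (h : Real.log k ≤ s * Real.log (1 / ε)) : dimRatio N ε ≤ s := by
  unfold dimRatio elog
  lift N to ℕ using ne_top_of_le_ne_top (ENat.natCast_ne_top k) hN
  have hpos : (0 : EReal) < (((Real.log (1 / ε))⁻¹ : ℝ) : EReal) := by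
    exact_mod_cast inv_pos.2 hε
  rcases Nat.eq_zero_or_pos N with rfl | hN0
  · rw [Nat.cast_zero, ENat.toENNReal_zero, if_pos rfl, EReal.bot_mul_of_pos hpos]
    exact bot_le
  · have hNk : N ≤ k := by exact_mod_cast hN
    rw [if_neg (by simpa using hN0.ne'), if_neg (by simp)]
    simp only [ENat.toENNReal_coe, ENNReal.toReal_natCast]
    rw [← EReal.coe_mul, EReal.coe_le_coe_iff, mul_inv_le_iff₀ hε]
    refine le_trans (Real.log_le_log (by exact_mod_cast hN0) (by exact_mod_cast hNk)) h

/-- Finitely supported measures have the least possible upper Wasserstein dimension. -/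
theorem upperWDim_le_of_finite_support {X : Type*} [PseudoMetricSpace X] [MeasurableSpace X]
    {μ : Measure X} {α : ℝ} (hα : 0 < α) {S : Finset X}
    (hSm : MeasurableSet (S : Set X)) (hS : μ S = 1) : upperWDim μ α ≤ ((2 * α : ℝ) : EReal) := by
  refine EReal.le_of_forall_lt_iff_le.1 fun s hs => sInf_le ⟨s, rfl, EReal.coe_lt_coe_iff.1 hs, ?_⟩
  have hs' : 2 * α < s := EReal.coe_lt_coe_iff.1 hs
  have hs0 : 0 < s := by linarith
  have hlog : Tendsto (fun ε : ℝ => Real.log (1 / ε)) (𝓝[>] 0) atTop := by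
    simp only [one_div]
    exact Real.tendsto_log_atTop.comp tendsto_inv_nhdsGT_zero
  refine limsup_le_of_le (by isBoundedDefault) ?_
  filter_upwards [hlog.eventually_gt_atTop 0, hlog.eventually_ge_atTop (Real.log S.card / s),
    self_mem_nhdsWithin] with ε h1 h2 hε
  have hε : 0 < ε := hε
  refine dimRatio_le_of_le (k := S.card) ?_ h1 (by rwa [div_le_iff₀' hs0] at h2)
  have hτ : 0 ≤ ε ^ (s * α / (s - 2 * α)) := by positivity
  refine (iInf₂_le (S : Set X) hSm).trans ((iInf_le _ ?_).trans (iInf₂_le S ?_))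
  · rw [hS, ← ENNReal.ofReal_one]
    exact ENNReal.ofReal_le_ofReal (by linarith)
  · exact fun x hx => mem_iUnion₂.2 ⟨x, hx, Metric.mem_closedBall_self hε.le⟩

theorem two_mem_upperBounds_holderClass {d : ℕ} {β : ℝ} (P Q : Measure (Fin d → ℝ))
    [IsProbabilityMeasure P] [IsProbabilityMeasure Q] :
    2 ∈ upperBounds (range fun f : HolderClass d β 1 => |∫ x, f.1 x ∂P - ∫ x, f.1 x ∂Q|) := by
  rintro _ ⟨f, rfl⟩
  have hb := abs_le_of_mem_holderClass zero_le_one f.2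
  have hP := norm_integral_le_of_norm_le_const (μ := P) (f := f.1) (Eventually.of_forall hb)
  have hQ := norm_integral_le_of_norm_le_const (μ := Q) (f := f.1) (Eventually.of_forall hb)
  simp only [Real.norm_eq_abs, probReal_univ, mul_one] at hP hQ
  exact (abs_sub _ _).trans (by linarith)

theorem le_ipm_holderClass {d : ℕ} {β : ℝ} (P Q : Measure (Fin d → ℝ))
    [IsProbabilityMeasure P] [IsProbabilityMeasure Q] {f : (Fin d → ℝ) → ℝ}
    (hf : f ∈ HolderClass d β 1) : |∫ x, f x ∂P - ∫ x, f x ∂Q| ≤ ipm (HolderClass d β 1) P Q :=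
  le_ciSup (f := fun f : HolderClass d β 1 => |∫ x, f.1 x ∂P - ∫ x, f.1 x ∂Q|)
    ⟨2, two_mem_upperBounds_holderClass P Q⟩ ⟨f, hf⟩

theorem abs_ipm_holderClass_le_two {d : ℕ} {β : ℝ} (P Q : Measure (Fin d → ℝ))
    [IsProbabilityMeasure P] [IsProbabilityMeasure Q] : |ipm (HolderClass d β 1) P Q| ≤ 2 := by
  rw [ipm, abs_of_nonneg (Real.iSup_nonneg fun _ => abs_nonneg _)]
  exact Real.iSup_le (fun f => two_mem_upperBounds_holderClass P Q ⟨f, rfl⟩) zero_le_two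

theorem bddAbove_range_risk {d n : ℕ} {β : ℝ}
    (muhat : (Fin n → (Fin d → ℝ)) → ProbabilityMeasure (Fin d → ℝ))
    (p : ProbabilityMeasure (Fin d → ℝ) → Prop) :
    BddAbove (range fun μ : {μ : ProbabilityMeasure (Fin d → ℝ) // p μ} =>
      ∫ x : Fin n → (Fin d → ℝ), ipm (HolderClass d β 1) (muhat x : Measure (Fin d → ℝ))
        (μ.1 : Measure (Fin d → ℝ)) ∂(Measure.pi fun _ => (μ.1 : Measure (Fin d → ℝ)))) := by
  refine ⟨2, ?_⟩
  rintro _ ⟨μ, rfl⟩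
  have h := norm_integral_le_of_norm_le_const
    (μ := Measure.pi fun _ : Fin n => (μ.1 : Measure (Fin d → ℝ)))
    (f := fun x => ipm (HolderClass d β 1) (muhat x : Measure (Fin d → ℝ)) (μ.1 : Measure _))
    (Eventually.of_forall fun x => abs_ipm_holderClass_le_two _ _)
  simp only [probReal_univ, mul_one] at h
  exact (le_abs_self _).trans h

/-- A pushforward of a measure on a finite space integrates every function. -/
theorem integral_map_of_finite {K X : Type*} [MeasurableSpace K] [Finite K]
    [MeasurableSingletonClass K] [MeasurableSpace X] [MeasurableSingletonClass X]
    (P : Measure K) [IsFiniteMeasure P] (φ : K → X) (F : X → ℝ) :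
    ∫ x, F x ∂(P.map φ) = ∫ k, F (φ k) ∂P := by
  have hφ : Measurable φ := measurable_of_finite φ
  refine integral_map hφ.aemeasurable ?_
  have hr : (P.map φ).restrict (range φ) = P.map φ :=
    Measure.restrict_eq_self_of_ae_mem <|
      (ae_map_iff hφ.aemeasurable (finite_range φ).measurableSet).2 (by simp)
  rw [← hr]
  exact (IntegrableOn.of_finite (finite_range φ)).aestronglyMeasurable

/-- The uniform probability measure on a finite type. -/
noncomputable def finUniform (ι : Type*) [Fintype ι] [MeasurableSpace ι] : Measure ι :=
  (Fintype.card ι : ℝ≥0∞)⁻¹ • Measure.count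

instance isProbabilityMeasure_finUniform (ι : Type*) [Fintype ι] [Nonempty ι] [MeasurableSpace ι]
    [MeasurableSingletonClass ι] : IsProbabilityMeasure (finUniform ι) := by
  refine ⟨?_⟩
  have h : (Fintype.card ι : ℝ≥0∞) ≠ 0 := by simp
  rw [finUniform, Measure.smul_apply, Measure.count_univ, smul_eq_mul]
  simpa using ENNReal.inv_mul_cancel h (by simp)

theorem integral_finUniform {ι : Type*} [Fintype ι] [Nonempty ι] [MeasurableSpace ι]
    [MeasurableSingletonClass ι] (F : ι → ℝ) :
    ∫ k, F k ∂(finUniform ι) = (Fintype.card ι : ℝ)⁻¹ * ∑ k, F k := by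
  rw [integral_fintype .of_finite, Finset.mul_sum]
  refine Finset.sum_congr rfl fun k _ => ?_
  simp [finUniform, measureReal_def]

theorem integral_pi_finUniform {ι : Type*} [Fintype ι] [Nonempty ι] [MeasurableSpace ι]
    [MeasurableSingletonClass ι] {n : ℕ} (F : (Fin n → ι) → ℝ) :
    ∫ k, F k ∂(Measure.pi fun _ : Fin n => finUniform ι)
      = ((Fintype.card ι : ℝ) ^ n)⁻¹ * ∑ k, F k := by
  classical
  rw [integral_fintype .of_finite, Finset.mul_sum]
  refine Finset.sum_congr rfl fun k _ => ?_
  rw [measureReal_def, Measure.pi_singleton]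
  simp [finUniform]

theorem integral_pi_map_finUniform {ι X : Type*} [Fintype ι] [Nonempty ι] [MeasurableSpace ι]
    [MeasurableSingletonClass ι] [MeasurableSpace X] [MeasurableSingletonClass X] {n : ℕ}
    (y : ι → X) (F : (Fin n → X) → ℝ) :
    ∫ x, F x ∂(Measure.pi fun _ : Fin n => (finUniform ι).map y)
      = ((Fintype.card ι : ℝ) ^ n)⁻¹ * ∑ k : Fin n → ι, F (fun i => y (k i)) := by
  have hy : Measurable y := measurable_of_finite y
  have : ∀ i : Fin n, IsProbabilityMeasure ((finUniform ι).map y) :=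
    fun _ => Measure.isProbabilityMeasure_map hy.aemeasurable
  rw [← Measure.pi_map_pi (fun _ => hy.aemeasurable), integral_map_of_finite,
    integral_pi_finUniform]

/-- Assouad-type averaging bound: coordinates of `σ` that a sample misses cannot be recovered. -/
theorem sum_abs_sub_ge {ι X : Type*} [Fintype ι] [DecidableEq ι] {n : ℕ}
    (T : (ι → Bool) → (Fin n → ι) → X) (a : X → ι → ℝ) {δ : ℝ}
    (hT : ∀ σ k j, j ∉ range k → T (Function.update σ j (!σ j)) k = T σ k) :
    Fintype.card ι * (Fintype.card ι - 1 : ℕ) ^ n * (2 ^ Fintype.card ι * δ) ≤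
      2 * ∑ σ : ι → Bool, ∑ k, ∑ j, |a (T σ k) j - if σ j then δ else 0| := by
  have key : ∀ j k, j ∉ range k → 2 ^ Fintype.card ι * δ ≤
      2 * ∑ σ : ι → Bool, |a (T σ k) j - if σ j then δ else 0| := by
    intro j k hjk
    have hinv : Function.Involutive fun σ : ι → Bool => Function.update σ j (!σ j) := by
      intro σ; simp
    have hflip := Equiv.sum_comp (hinv.toPerm _)
      fun σ : ι → Bool => |a (T σ k) j - if σ j then δ else 0|
    rw [two_mul]
    nth_rw 1 [← hflip]
    rw [← Finset.sum_add_distrib]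
    have hcard : (2 : ℝ) ^ Fintype.card ι * δ = ∑ _σ : ι → Bool, δ := by simp
    rw [hcard]
    refine Finset.sum_le_sum fun σ _ => ?_
    simp only [Function.Involutive.coe_toPerm, hT σ k j hjk, Function.update_self]
    have h := abs_sub (a (T σ k) j) (a (T σ k) j - δ)
    rw [sub_sub_cancel] at h
    have h' := (le_abs_self δ).trans h
    cases σ j
    · simpa [add_comm] using h'
    · simpa using h'
  have hmiss : ∀ j : ι, (Finset.univ.filter fun k : Fin n → ι => j ∉ range k).card
      = (Fintype.card ι - 1) ^ n := by
    intro j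
    have : (Finset.univ.filter fun k : Fin n → ι => j ∉ range k)
        = Fintype.piFinset fun _ => Finset.univ.erase j := by
      ext k; simp
    rw [this]
    simp
  have hswap : ∑ σ : ι → Bool, ∑ k, ∑ j, |a (T σ k) j - if σ j then δ else 0|
      = ∑ j, ∑ k, ∑ σ : ι → Bool, |a (T σ k) j - if σ j then δ else 0| := by
    rw [Finset.sum_comm, Finset.sum_congr rfl fun k _ => Finset.sum_comm, Finset.sum_comm]
  rw [hswap, Finset.mul_sum, mul_assoc]
  have hj : ∀ j, ((Fintype.card ι - 1 : ℕ) : ℝ) ^ n * (2 ^ Fintype.card ι * δ) ≤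
      2 * ∑ k, ∑ σ : ι → Bool, |a (T σ k) j - if σ j then δ else 0| := by
    intro j
    calc ((Fintype.card ι - 1 : ℕ) : ℝ) ^ n * (2 ^ Fintype.card ι * δ)
        = ∑ k ∈ Finset.univ.filter (fun k : Fin n → ι => j ∉ range k),
            2 ^ Fintype.card ι * δ := by
          rw [Finset.sum_const, hmiss, nsmul_eq_mul, Nat.cast_pow]
      _ ≤ ∑ k ∈ Finset.univ.filter (fun k : Fin n → ι => j ∉ range k),
            2 * ∑ σ : ι → Bool, |a (T σ k) j - if σ j then δ else 0| :=
          Finset.sum_le_sum fun k hk => key j k (Finset.mem_filter.1 hk).2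
      _ ≤ ∑ k, 2 * ∑ σ : ι → Bool, |a (T σ k) j - if σ j then δ else 0| :=
          Finset.sum_le_univ_sum_of_nonneg fun k =>
            mul_nonneg zero_le_two (Finset.sum_nonneg fun _ _ => abs_nonneg _)
      _ = _ := by rw [Finset.mul_sum]
  calc _ = ∑ _j : ι, ((Fintype.card ι - 1 : ℕ) : ℝ) ^ n * (2 ^ Fintype.card ι * δ) := by simp
    _ ≤ _ := Finset.sum_le_sum fun j _ => hj j

theorem latticeComb_eq_of_smul_eq {d : ℕ} {ι : Type*} [Fintype ι] {c : ℝ} {z : ι → Fin d → ℝ}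
    (hz : Pairwise fun i j => 1 ≤ ‖z i - z j‖) {w : ι → ℝ} {g : (Fin d → ℝ) → ℝ}
    (hs : tsupport g ⊆ Metric.closedBall 0 (1 / 4)) (hg0 : g 0 = 1) {x : Fin d → ℝ} {k : ι}
    (hx : c • x = z k) : latticeComb c z w g x = w k := by
  rw [latticeComb, hx, Finset.sum_eq_single k]
  · simp [hg0]
  · intro j _ hj
    rw [eq_zero_of_tsupport_subset_ball hs, mul_zero]
    have := hz hj.symm
    dsimp only at this
    linarith
  · simp

theorem latticeComb_zero {d : ℕ} {ι : Type*} [Fintype ι] {c : ℝ} {z : ι → Fin d → ℝ}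
    (hz : ∀ j, 1 ≤ ‖z j‖) {w : ι → ℝ} {g : (Fin d → ℝ) → ℝ}
    (hs : tsupport g ⊆ Metric.closedBall 0 (1 / 4)) : latticeComb c z w g 0 = 0 := by
  refine Finset.sum_eq_zero fun j _ => ?_
  rw [eq_zero_of_tsupport_subset_ball hs, mul_zero]
  rw [smul_zero, zero_sub, norm_neg]
  linarith [hz j]

theorem integral_latticeComb {d : ℕ} {ι : Type*} [Fintype ι] {g : (Fin d → ℝ) → ℝ}
    (hg : Continuous g) (hc : HasCompactSupport g) (c : ℝ) (z : ι → Fin d → ℝ) (w : ι → ℝ)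
    (ν : Measure (Fin d → ℝ)) [IsProbabilityMeasure ν] :
    ∫ x, latticeComb c z w g x ∂ν = ∑ j, w j * ∫ x, g (c • x - z j) ∂ν := by
  obtain ⟨M, hM⟩ := hc.exists_bound_of_continuous hg
  have hint : ∀ j, Integrable (fun x => g (c • x - z j)) ν := fun j =>
    Integrable.of_bound (by fun_prop : Continuous fun x => g (c • x - z j)).aestronglyMeasurable M
      (Eventually.of_forall fun x => hM _)
  unfold latticeComb
  rw [integral_finsetSum _ fun j _ => (hint j).const_mul _]
  simp only [integral_const_mul]

/-- The points indexed by `σ` are moved to the lattice, all others to the origin. -/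
noncomputable def vertexPoint {d : ℕ} {ι : Type*} (c : ℝ) (z : ι → Fin d → ℝ) (σ : ι → Bool)
    (j : ι) : Fin d → ℝ :=
  if σ j then c⁻¹ • z j else 0

/-- The hypothesis measure indexed by the vertex `σ` of the hypercube. -/
noncomputable def vertexMeasure {d : ℕ} {ι : Type*} [Fintype ι] [MeasurableSpace ι] (c : ℝ)
    (z : ι → Fin d → ℝ) (σ : ι → Bool) : Measure (Fin d → ℝ) :=
  (finUniform ι).map (vertexPoint c z σ)

section

variable {d : ℕ} {ι : Type} [Fintype ι] [Nonempty ι] [MeasurableSpace ι]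
  [MeasurableSingletonClass ι]

instance isProbabilityMeasure_vertexMeasure (c : ℝ) (z : ι → Fin d → ℝ) (σ : ι → Bool) :
    IsProbabilityMeasure (vertexMeasure c z σ) :=
  Measure.isProbabilityMeasure_map (measurable_of_finite _).aemeasurable

theorem integral_latticeComb_vertexMeasure {c : ℝ} (hc : c ≠ 0) {z : ι → Fin d → ℝ}
    (hz : Pairwise fun i j => 1 ≤ ‖z i - z j‖) (hz0 : ∀ j, 1 ≤ ‖z j‖) (w : ι → ℝ)
    {g : (Fin d → ℝ) → ℝ} (hs : tsupport g ⊆ Metric.closedBall 0 (1 / 4)) (hg0 : g 0 = 1)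
    (σ : ι → Bool) :
    ∫ x, latticeComb c z w g x ∂(vertexMeasure c z σ)
      = ∑ j, w j * if σ j then (Fintype.card ι : ℝ)⁻¹ else 0 := by
  rw [vertexMeasure, integral_map_of_finite, integral_finUniform, Finset.mul_sum]
  refine Finset.sum_congr rfl fun j _ => ?_
  unfold vertexPoint
  split_ifs
  · rw [latticeComb_eq_of_smul_eq hz hs hg0 (smul_inv_smul₀ hc _), mul_comm]
  · rw [latticeComb_zero hz0 hs, mul_zero, mul_zero]

/-- The integral probability metric to a vertex measure dominates a weighted Hamming loss. -/
theorem le_ipm_vertexMeasure {β A c : ℝ} {g : (Fin d → ℝ) → ℝ} {z : ι → Fin d → ℝ}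
    (hA : 0 ≤ A) (hc : 0 < c)
    (hz : Pairwise fun i j => 1 ≤ ‖z i - z j‖) (hz0 : ∀ j, 1 ≤ ‖z j‖)
    (hg : Continuous g) (hs : tsupport g ⊆ Metric.closedBall 0 (1 / 4)) (hg0 : g 0 = 1)
    (hmem : ∀ w : ι → ℝ, (∀ j, |w j| ≤ A * c ^ (-β)) → latticeComb c z w g ∈ HolderClass d β 1)
    (ν : Measure (Fin d → ℝ)) [IsProbabilityMeasure ν] (σ : ι → Bool) :
    A * c ^ (-β) * ∑ j, |∫ x, g (c • x - z j) ∂ν - if σ j then (Fintype.card ι : ℝ)⁻¹ else 0|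
      ≤ ipm (HolderClass d β 1) ν (vertexMeasure c z σ) := by
  have hcs : HasCompactSupport g :=
    (isCompact_closedBall (0 : Fin d → ℝ) (1 / 4)).of_isClosed_subset (isClosed_tsupport _) hs
  set b : ι → ℝ := fun j => ∫ x, g (c • x - z j) ∂ν - if σ j then (Fintype.card ι : ℝ)⁻¹ else 0
  have hpos : 0 ≤ A * c ^ (-β) := by positivity
  set w : ι → ℝ := fun j => A * c ^ (-β) * (SignType.sign (b j) : ℝ) with hw
  have hwle : ∀ j, |w j| ≤ A * c ^ (-β) := by
    intro j
    rw [hw, abs_mul, abs_of_nonneg hpos]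
    refine mul_le_of_le_one_right hpos ?_
    rcases SignType.sign (b j) with _ | _ | _ <;> simp
  refine le_trans (le_of_eq ?_)
    ((le_abs_self _).trans (le_ipm_holderClass ν (vertexMeasure c z σ) (hmem w hwle)))
  rw [integral_latticeComb hg hcs, integral_latticeComb_vertexMeasure hc.ne' hz hz0 w hs hg0,
    ← Finset.sum_sub_distrib, Finset.mul_sum]
  refine Finset.sum_congr rfl fun j _ => ?_
  rw [← mul_sub]
  change _ * |b j| = A * c ^ (-β) * (SignType.sign (b j) : ℝ) * b j
  rw [mul_assoc (A * c ^ (-β)), sign_mul_self]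

theorem risk_vertexMeasure_lower_bound {n : ℕ} {β A c V : ℝ} {g : (Fin d → ℝ) → ℝ}
    {z : ι → Fin d → ℝ} (hA : 0 ≤ A) (hc : 0 < c)
    (hz : Pairwise fun i j => 1 ≤ ‖z i - z j‖) (hz0 : ∀ j, 1 ≤ ‖z j‖)
    (hg : Continuous g) (hs : tsupport g ⊆ Metric.closedBall 0 (1 / 4)) (hg0 : g 0 = 1)
    (hmem : ∀ w : ι → ℝ, (∀ j, |w j| ≤ A * c ^ (-β)) → latticeComb c z w g ∈ HolderClass d β 1)
    (hn : 2 * n ≤ Fintype.card ι)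
    (muhat : (Fin n → (Fin d → ℝ)) → ProbabilityMeasure (Fin d → ℝ))
    (hV : ∀ σ : ι → Bool, ∫ x, ipm (HolderClass d β 1) (muhat x : Measure (Fin d → ℝ))
      (vertexMeasure c z σ) ∂(Measure.pi fun _ => vertexMeasure c z σ) ≤ V) :
    A * c ^ (-β) / 4 ≤ V := by
  classical
  set J := Fintype.card ι with hJ
  have hJ1 : 1 ≤ J := Fintype.card_pos
  have hJ0 : (0 : ℝ) < J := by exact_mod_cast hJ1
  set H : ℝ := A * c ^ (-β) with hH
  have hH0 : 0 ≤ H := by positivity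
  set T : (ι → Bool) → (Fin n → ι) → (Fin n → Fin d → ℝ) :=
    fun σ k i => vertexPoint c z σ (k i) with hT
  set a : (Fin n → Fin d → ℝ) → ι → ℝ :=
    fun x j => ∫ u, g (c • u - z j) ∂(muhat x : Measure (Fin d → ℝ))
  have hass := sum_abs_sub_ge T a (δ := (J : ℝ)⁻¹) (by
    intro σ k j hj
    funext i
    have hne : k i ≠ j := fun h => hj ⟨i, h⟩
    simp [hT, vertexPoint, hne])
  set S := ∑ σ : ι → Bool, ∑ k, ∑ j, |a (T σ k) j - if σ j then (J : ℝ)⁻¹ else 0| with hS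
  have hσ : ∀ σ : ι → Bool, ((J : ℝ) ^ n)⁻¹ *
      (H * ∑ k, ∑ j, |a (T σ k) j - if σ j then (J : ℝ)⁻¹ else 0|) ≤ V := by
    intro σ
    refine le_trans ?_ (hV σ)
    unfold vertexMeasure
    rw [integral_pi_map_finUniform, Finset.mul_sum]
    refine mul_le_mul_of_nonneg_left (Finset.sum_le_sum fun k _ => ?_) (by positivity)
    exact le_ipm_vertexMeasure hA hc hz hz0 hg hs hg0 hmem _ σ
  have hsum : ((J : ℝ) ^ n)⁻¹ * (H * S) ≤ 2 ^ J * V := by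
    have h := Finset.sum_le_sum fun σ (_ : σ ∈ Finset.univ) => hσ σ
    rw [← Finset.mul_sum, ← Finset.mul_sum] at h
    simpa using h
  have hbern : (1 : ℝ) / 2 ≤ ((J : ℝ) ^ n)⁻¹ * ((J - 1 : ℕ) : ℝ) ^ n := by
    have h1 : ((J : ℝ) ^ n)⁻¹ * ((J - 1 : ℕ) : ℝ) ^ n = (1 + -(J : ℝ)⁻¹) ^ n := by
      rw [← inv_pow, ← mul_pow, Nat.cast_sub hJ1]
      congr 1
      field_simp
      push_cast
      ring
    have h2 : (J : ℝ)⁻¹ ≤ 1 := inv_le_one_of_one_le₀ (by exact_mod_cast hJ1)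
    have h3 : (n : ℝ) * (J : ℝ)⁻¹ ≤ 1 / 2 := by
      rw [← div_eq_mul_inv, div_le_iff₀ hJ0]
      have : (2 : ℝ) * n ≤ J := by exact_mod_cast hn
      linarith
    rw [h1]
    refine le_trans ?_ (one_add_mul_le_pow (by linarith) n)
    linarith
  have hS2 : ((J - 1 : ℕ) : ℝ) ^ n * 2 ^ J ≤ 2 * S := by
    refine le_of_eq_of_le ?_ hass
    rw [← hJ]
    field_simp
  have h2J : (0 : ℝ) < 2 ^ J := by positivity
  refine le_of_mul_le_mul_left ?_ h2J
  refine le_trans ?_ hsum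
  calc (2 : ℝ) ^ J * (H / 4) = H * 2 ^ J / 2 * (1 / 2) := by ring
    _ ≤ H * 2 ^ J / 2 * (((J : ℝ) ^ n)⁻¹ * ((J - 1 : ℕ) : ℝ) ^ n) := by gcongr
    _ = ((J : ℝ) ^ n)⁻¹ * (H * ((((J - 1 : ℕ) : ℝ) ^ n * 2 ^ J) / 2)) := by ring
    _ ≤ ((J : ℝ) ^ n)⁻¹ * (H * S) := by gcongr; linarith

end

theorem vertexMeasure_support {d : ℕ} {ι : Type} [Fintype ι] [Nonempty ι] [MeasurableSpace ι]
    [MeasurableSingletonClass ι] (c : ℝ) (z : ι → Fin d → ℝ) (σ : ι → Bool)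
    {s : Set (Fin d → ℝ)} (hs : MeasurableSet s) (h : ∀ j, vertexPoint c z σ j ∈ s) :
    vertexMeasure c z σ s = 1 := by
  rw [vertexMeasure, Measure.map_apply (measurable_of_finite _) hs]
  have : vertexPoint c z σ ⁻¹' s = univ := eq_univ_of_forall h
  rw [this, measure_univ]

/-- The lattice points `{1, …, m}^d`. -/
def latticePoint {d m : ℕ} (j : Fin d → Fin m) : Fin d → ℝ := fun i => (j i : ℝ) + 1

theorem pairwise_one_le_norm_latticePoint_sub {d m : ℕ} :
    Pairwise fun i j : Fin d → Fin m => 1 ≤ ‖latticePoint i - latticePoint j‖ := by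
  intro i j hij
  obtain ⟨l, hl⟩ := Function.ne_iff.1 hij
  refine le_trans ?_ (norm_le_pi_norm _ l)
  have hne : ((i l : ℕ) : ℤ) - (j l : ℕ) ≠ 0 := by
    rw [sub_ne_zero]
    exact_mod_cast fun h => hl (Fin.ext h)
  have h1 := Int.one_le_abs hne
  have h2 : (1 : ℝ) ≤ |((i l : ℕ) : ℝ) - (j l : ℕ)| := by exact_mod_cast h1
  simpa [latticePoint, Real.norm_eq_abs] using h2

theorem one_le_norm_latticePoint {d m : ℕ} (hd : 0 < d) (j : Fin d → Fin m) :
    1 ≤ ‖latticePoint j‖ := by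
  refine le_trans ?_ (norm_le_pi_norm _ ⟨0, hd⟩)
  rw [latticePoint, Real.norm_of_nonneg (by positivity)]
  simp

theorem vertexPoint_latticePoint_mem_Icc {d m : ℕ} (σ : (Fin d → Fin m) → Bool)
    (j : Fin d → Fin m) : vertexPoint (m : ℝ) latticePoint σ j ∈ Icc (0 : Fin d → ℝ) 1 := by
  unfold vertexPoint
  split_ifs
  · refine ⟨fun i => ?_, fun i => ?_⟩
    · simp only [Pi.zero_apply, Pi.smul_apply, latticePoint, smul_eq_mul]
      positivity
    · have hi := (j i).isLt
      have hm : (0 : ℝ) < m := by exact_mod_cast (Nat.zero_le _).trans_lt hi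
      simp only [Pi.one_apply, Pi.smul_apply, latticePoint, smul_eq_mul]
      rw [inv_mul_le_iff₀ hm, mul_one]
      exact_mod_cast hi
  · simp

theorem exists_grid_size {d n : ℕ} (hd : 0 < d) (hn : 1 ≤ n) :
    ∃ m : ℕ, 1 ≤ m ∧ 2 * n ≤ m ^ d ∧ (m : ℝ) ≤ 4 * (n : ℝ) ^ ((d : ℝ)⁻¹) := by
  have hn' : (1 : ℝ) ≤ n := by exact_mod_cast hn
  have hr : 1 ≤ (n : ℝ) ^ ((d : ℝ)⁻¹) := Real.one_le_rpow hn' (by positivity)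
  set k := ⌈(n : ℝ) ^ ((d : ℝ)⁻¹)⌉₊ with hk
  have hk1 : (n : ℝ) ^ ((d : ℝ)⁻¹) ≤ k := Nat.le_ceil _
  have hk2 : (k : ℝ) < (n : ℝ) ^ ((d : ℝ)⁻¹) + 1 := Nat.ceil_lt_add_one (by positivity)
  have hkn : n ≤ k ^ d := by
    have h : ((n : ℝ) ^ ((d : ℝ)⁻¹)) ^ d ≤ (k : ℝ) ^ d := by gcongr
    rw [Real.rpow_inv_natCast_pow (by positivity) hd.ne'] at h
    exact_mod_cast h
  have hk0 : 1 ≤ k := by exact_mod_cast hr.trans hk1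
  refine ⟨2 * k, by omega, ?_, by push_cast; linarith⟩
  rw [mul_pow]
  exact Nat.mul_le_mul (Nat.le_self_pow hd.ne' 2) hkn

/-- Minimax lower bound over the class `M^{d⋆,β}` of Borel probability
measures on `[0,1]^d` whose `β`-upper Wasserstein dimension is at most `d⋆ ∈ [2β, d]`:
for every `0 < s < d⋆` there are `c > 0` and `n₀` such that every (Borel-measurably chosen,
for the weak topology) estimator `μ̂` based on `n ≥ n₀` i.i.d. samples satisfies
`sup_{μ ∈ M^{d⋆,β}} E‖μ̂ − μ‖_{H^β(ℝ^d,ℝ,1)} ≥ c n^{-β/s}`. -/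
theorem minimax_lower_bound_upperWDim_class
    (d : ℕ) (β : ℝ) (hβ : 0 < β) (hd : 2 * β ≤ (d : ℝ))
    (dstar : ℝ) (hdstar1 : 2 * β ≤ dstar) (hdstar2 : dstar ≤ (d : ℝ))
    (s : ℝ) (hs0 : 0 < s) (hs : s < dstar) :
    ∃ c > (0 : ℝ), ∃ n₀ : ℕ, ∀ n : ℕ, n₀ ≤ n →
      ∀ muhat : (Fin n → (Fin d → ℝ)) → ProbabilityMeasure (Fin d → ℝ),
        (∀ x, (muhat x : Measure (Fin d → ℝ)) (Set.Icc 0 1) = 1) →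
        (@Measurable _ _ inferInstance (borel (ProbabilityMeasure (Fin d → ℝ))) muhat) →
        c * (n : ℝ) ^ (-(β / s)) ≤
          ⨆ μ : {μ : ProbabilityMeasure (Fin d → ℝ) //
              (μ : Measure (Fin d → ℝ)) (Set.Icc 0 1) = 1 ∧
              upperWDim (μ : Measure (Fin d → ℝ)) β ≤ (dstar : EReal)},
            ∫ x : Fin n → (Fin d → ℝ),
              ipm (HolderClass d β 1) (muhat x : Measure (Fin d → ℝ))
                (μ.1 : Measure (Fin d → ℝ))
              ∂(Measure.pi fun _ => (μ.1 : Measure (Fin d → ℝ))) := by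
  have hd0 : 0 < d := by
    have : (0 : ℝ) < d := by linarith
    exact_mod_cast this
  let ψ : ContDiffBump (0 : Fin d → ℝ) := ⟨1 / 8, 1 / 4, by norm_num, by norm_num⟩
  have hψs : tsupport ψ ⊆ Metric.closedBall 0 (1 / 4) := ψ.tsupport_eq.subset
  have hψ0 : ψ 0 = 1 := ψ.one_of_mem_closedBall (Metric.mem_closedBall_self ψ.rIn_pos.le)
  obtain ⟨A, hA, hmem⟩ := exists_latticeComb_mem_holderClass hβ ψ.contDiff hψs
  refine ⟨A * 4 ^ (-β) / 4, by positivity, 1, fun n hn muhat _ _ => ?_⟩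
  obtain ⟨m, hm1, hmn, hm⟩ := exists_grid_size hd0 hn
  have hm0 : (0 : ℝ) < m := by exact_mod_cast hm1
  have hn1 : (1 : ℝ) ≤ n := by exact_mod_cast hn
  have : NeZero m := ⟨by omega⟩
  have hrate : (4 : ℝ) ^ (-β) * (n : ℝ) ^ (-(β / s)) ≤ (m : ℝ) ^ (-β) := by
    calc (4 : ℝ) ^ (-β) * (n : ℝ) ^ (-(β / s)) ≤ 4 ^ (-β) * (n : ℝ) ^ ((d : ℝ)⁻¹ * -β) := by
          refine mul_le_mul_of_nonneg_left (Real.rpow_le_rpow_of_exponent_le hn1 ?_) (by positivity)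
          rw [mul_neg, neg_le_neg_iff, ← div_eq_inv_mul]
          gcongr
          linarith
      _ = (4 * (n : ℝ) ^ ((d : ℝ)⁻¹)) ^ (-β) := by
          rw [Real.mul_rpow (by norm_num) (by positivity), Real.rpow_mul (by positivity)]
      _ ≤ (m : ℝ) ^ (-β) := Real.rpow_le_rpow_of_nonpos hm0 hm (by linarith)
  refine le_trans (b := A * (m : ℝ) ^ (-β) / 4) ?_ ?_
  · calc _ = A * (4 ^ (-β) * (n : ℝ) ^ (-(β / s))) / 4 := by ring
      _ ≤ _ := by gcongr
  refine risk_vertexMeasure_lower_bound (ι := Fin d → Fin m) (z := latticePoint) hA.le hm0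
    pairwise_one_le_norm_latticePoint_sub (one_le_norm_latticePoint hd0) ψ.continuous hψs hψ0
    (fun w => hmem _ _ (by exact_mod_cast hm1) _ w pairwise_one_le_norm_latticePoint_sub)
    (by simpa using hmn) muhat fun σ => ?_
  classical
  have hdim : upperWDim (vertexMeasure (m : ℝ) latticePoint σ) β ≤ (dstar : EReal) := by
    refine (upperWDim_le_of_finite_support hβ
      (S := Finset.univ.image (vertexPoint (m : ℝ) latticePoint σ)) ?_ ?_).trans
      (EReal.coe_le_coe_iff.2 hdstar1)
    · exact Finset.measurableSet _
    · exact vertexMeasure_support _ _ _ (Finset.measurableSet _) fun j => by simp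
  exact le_ciSup (bddAbove_range_risk muhat _)
    ⟨⟨vertexMeasure (m : ℝ) latticePoint σ, inferInstance⟩,
    vertexMeasure_support _ _ _ measurableSet_Icc (vertexPoint_latticePoint_mem_Icc σ), hdim⟩
end

section
/- Let β > 0 and d ∈ ℕ with d ≥ 2β. For every real number d⋆ ∈ [2β, d] there exists a Borel probability measure μ⋆ on [0,1]^d such that its β-upper Wasserstein dimension and its lower Wasserstein dimension both equal d⋆: d*_β(μ⋆) = d_*(μ⋆) = d⋆. -/
open Filter Topology MeasureTheory Set
open scoped ENNReal NNReal

open Filter Topology MeasureTheory Set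
open scoped ENNReal

/-- Reads the binary digits of a natural number in base `R`. -/
noncomputable def digitSpread (R : ℝ) (m : ℕ) : ℝ :=
  if _h : m = 0 then 0 else R * digitSpread R (m / 2) + (m % 2 : ℕ)
decreasing_by omega

lemma digitSpread_zero (R : ℝ) : digitSpread R 0 = 0 := by
  rw [digitSpread]; simp

lemma digitSpread_rec (R : ℝ) (m : ℕ) :
    digitSpread R m = R * digitSpread R (m / 2) + (m % 2 : ℕ) := by
  rcases eq_or_ne m 0 with rfl | h
  · simp [digitSpread_zero]
  · rw [digitSpread, dif_neg h]

lemma digitSpread_two_mul (R : ℝ) (m : ℕ) : digitSpread R (2 * m) = R * digitSpread R m := by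
  rw [digitSpread_rec]; simp

lemma digitSpread_two_mul_add_one (R : ℝ) (m : ℕ) :
    digitSpread R (2 * m + 1) = R * digitSpread R m + 1 := by
  rw [digitSpread_rec, show (2 * m + 1) / 2 = m by omega, show (2 * m + 1) % 2 = 1 by omega]
  simp

lemma digitSpread_add_one_le {R : ℝ} (hR : 2 ≤ R) (m : ℕ) :
    digitSpread R m + 1 ≤ digitSpread R (m + 1) := by
  induction m using Nat.strong_induction_on with
  | _ m ih =>
    rcases Nat.even_or_odd' m with ⟨k, rfl | rfl⟩
    · rw [digitSpread_two_mul, digitSpread_two_mul_add_one]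
    · have := ih k (by omega)
      rw [show 2 * k + 1 + 1 = 2 * (k + 1) by ring, digitSpread_two_mul,
        digitSpread_two_mul_add_one]
      nlinarith

lemma digitSpread_mono {R : ℝ} (hR : 2 ≤ R) : Monotone (digitSpread R) :=
  monotone_nat_of_le_succ fun m => by linarith [digitSpread_add_one_le hR m]

lemma digitSpread_nonneg {R : ℝ} (hR : 2 ≤ R) (m : ℕ) : 0 ≤ digitSpread R m := by
  simpa [digitSpread_zero] using digitSpread_mono hR (Nat.zero_le m)

lemma le_digitSpread {R : ℝ} (hR : 2 ≤ R) (m j : ℕ) :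
    R ^ j * digitSpread R (m / 2 ^ j) ≤ digitSpread R m := by
  induction j with
  | zero => simp
  | succ j ih =>
    refine le_trans ?_ ih
    have h := digitSpread_rec R (m / 2 ^ j)
    rw [Nat.div_div_eq_div_mul, ← pow_succ] at h
    rw [h, pow_succ, mul_assoc]
    gcongr
    simp

lemma digitSpread_add_one_le_pow_mul {R : ℝ} (hR : 2 ≤ R) (m j : ℕ) :
    digitSpread R m + 1 ≤ R ^ j * (digitSpread R (m / 2 ^ j) + 1) := by
  induction j with
  | zero => simp
  | succ j ih =>
    refine ih.trans ?_
    have h := digitSpread_rec R (m / 2 ^ j)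
    rw [Nat.div_div_eq_div_mul, ← pow_succ] at h
    rw [h, pow_succ R, mul_assoc]
    gcongr
    have : ((m / 2 ^ j % 2 : ℕ) : ℝ) ≤ 1 := by
      exact_mod_cast Nat.le_of_lt_succ (Nat.mod_lt _ two_pos)
    linarith

/-- The `n`-th approximation of `cantorMap`. -/
noncomputable def cantorApprox (R : ℝ) (n : ℕ) (x : ℝ) : ℝ :=
  (R ^ n)⁻¹ * digitSpread R ⌊2 ^ n * x⌋₊

/-- The map sending `∑ bₖ 2⁻ᵏ` to `∑ bₖ R⁻ᵏ` up to scaling: its image of `[0, 1)` is, up to a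
countable set, a Cantor set of dimension `log 2 / log R`. -/
noncomputable def cantorMap (R x : ℝ) : ℝ := ⨆ n, cantorApprox R n x

lemma natFloor_two_pow_mul_div (x : ℝ) (n j : ℕ) :
    ⌊2 ^ (n + j) * x⌋₊ / 2 ^ j = ⌊2 ^ n * x⌋₊ := by
  have := Nat.floor_div_natCast (2 ^ (n + j) * x) (2 ^ j)
  rw [← this]
  congr 1
  push_cast
  rw [pow_add]
  field_simp

lemma cantorApprox_mono_index {R : ℝ} (hR : 2 ≤ R) (x : ℝ) :
    Monotone fun n => cantorApprox R n x := by
  intro n k hnk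
  obtain ⟨j, rfl⟩ := Nat.exists_eq_add_of_le hnk
  have h := le_digitSpread hR ⌊2 ^ (n + j) * x⌋₊ j
  rw [natFloor_two_pow_mul_div] at h
  have hR0 : 0 < R := by linarith
  calc (R ^ n)⁻¹ * digitSpread R ⌊2 ^ n * x⌋₊
      = (R ^ (n + j))⁻¹ * (R ^ j * digitSpread R ⌊2 ^ n * x⌋₊) := by
        rw [pow_add R]; field_simp
    _ ≤ (R ^ (n + j))⁻¹ * digitSpread R ⌊2 ^ (n + j) * x⌋₊ := by gcongr

lemma cantorApprox_le {R : ℝ} (hR : 2 ≤ R) (x : ℝ) (n k : ℕ) :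
    cantorApprox R k x ≤ (R ^ n)⁻¹ * (digitSpread R ⌊2 ^ n * x⌋₊ + 1) := by
  have hR0 : 0 < R := by linarith
  refine (cantorApprox_mono_index hR x (Nat.le_add_left k n)).trans ?_
  have h := digitSpread_add_one_le_pow_mul hR ⌊2 ^ (n + k) * x⌋₊ k
  rw [natFloor_two_pow_mul_div] at h
  calc (R ^ (n + k))⁻¹ * digitSpread R ⌊2 ^ (n + k) * x⌋₊
      ≤ (R ^ (n + k))⁻¹ * (R ^ k * (digitSpread R ⌊2 ^ n * x⌋₊ + 1)) := by
        gcongr; linarith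
    _ = (R ^ n)⁻¹ * (digitSpread R ⌊2 ^ n * x⌋₊ + 1) := by
        rw [pow_add R]; field_simp

lemma cantorMap_le {R : ℝ} (hR : 2 ≤ R) (x : ℝ) (n : ℕ) :
    cantorMap R x ≤ (R ^ n)⁻¹ * (digitSpread R ⌊2 ^ n * x⌋₊ + 1) :=
  ciSup_le fun k => cantorApprox_le hR x n k

lemma bddAbove_cantorApprox {R : ℝ} (hR : 2 ≤ R) (x : ℝ) :
    BddAbove (range fun n => cantorApprox R n x) :=
  ⟨_, by rintro _ ⟨k, rfl⟩; exact cantorApprox_le hR x 0 k⟩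

lemma le_cantorMap {R : ℝ} (hR : 2 ≤ R) (x : ℝ) (n : ℕ) :
    (R ^ n)⁻¹ * digitSpread R ⌊2 ^ n * x⌋₊ ≤ cantorMap R x :=
  le_ciSup (bddAbove_cantorApprox hR x) n

lemma cantorMap_mono {R : ℝ} (hR : 2 ≤ R) : Monotone (cantorMap R) := by
  intro x y hxy
  refine ciSup_mono (bddAbove_cantorApprox hR y) fun n => ?_
  have hR0 : 0 < R := by linarith
  unfold cantorApprox
  gcongr
  exact digitSpread_mono hR (by gcongr)

lemma inv_pow_le_cantorMap_sub {R : ℝ} (hR : 2 ≤ R) {x y : ℝ} (hx : 0 ≤ x) (n : ℕ)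
    (hxy : x + 2 * (2 ^ n)⁻¹ ≤ y) : (R ^ n)⁻¹ ≤ cantorMap R y - cantorMap R x := by
  have hR0 : 0 < R := by linarith
  have h1 := cantorMap_le hR x n
  have h2 := le_cantorMap hR y n
  have h3 : ⌊2 ^ n * x⌋₊ + 2 ≤ ⌊2 ^ n * y⌋₊ := by
    rw [← Nat.floor_add_ofNat (by positivity)]
    refine Nat.floor_mono ?_
    have : (2 : ℝ) ^ n * (x + 2 * (2 ^ n)⁻¹) ≤ 2 ^ n * y := by gcongr
    rw [mul_add] at this
    field_simp at this
    linarith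
  have h4 := digitSpread_mono hR h3
  have h5 := digitSpread_add_one_le hR ⌊2 ^ n * x⌋₊
  have h6 := digitSpread_add_one_le hR (⌊2 ^ n * x⌋₊ + 1)
  have h7 : (R ^ n)⁻¹ * (digitSpread R ⌊2 ^ n * x⌋₊ + 2) ≤
      (R ^ n)⁻¹ * digitSpread R ⌊2 ^ n * y⌋₊ := by
    gcongr
    linarith
  linarith

/-- The uniform probability measure on the Cantor set of dimension `log 2 / log R`. -/
noncomputable def cantorMeasure (R : ℝ) : Measure ℝ :=
  (volume.restrict (Ico (0 : ℝ) 1)).map (cantorMap R)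

lemma isProbabilityMeasure_cantorMeasure {R : ℝ} (hR : 2 ≤ R) :
    IsProbabilityMeasure (cantorMeasure R) := by
  have : IsProbabilityMeasure (volume.restrict (Ico (0 : ℝ) 1)) := ⟨by simp⟩
  exact Measure.isProbabilityMeasure_map (cantorMap_mono hR).measurable.aemeasurable

lemma cantorMeasure_eq_one {R : ℝ} (hR : 2 ≤ R) {S : Set ℝ} (hS : MeasurableSet S)
    (h : ∀ x ∈ Ico (0 : ℝ) 1, cantorMap R x ∈ S) : cantorMeasure R S = 1 := by
  have hm := (cantorMap_mono hR).measurable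
  rw [cantorMeasure, Measure.map_apply hm hS, Measure.restrict_apply (hm hS),
    inter_eq_right.2 (show Ico 0 1 ⊆ cantorMap R ⁻¹' S from h)]
  simp

lemma cantorMeasure_Icc {R : ℝ} (hR : 2 ≤ R) : cantorMeasure R (Icc 0 1) = 1 := by
  refine cantorMeasure_eq_one hR measurableSet_Icc fun x hx => ?_
  have h0 : ⌊x⌋₊ = 0 := Nat.floor_eq_zero.2 hx.2
  have h1 := cantorMap_le hR x 0
  have h2 := le_cantorMap hR x 0
  simp only [pow_zero, inv_one, one_mul, h0, digitSpread_zero] at h1 h2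
  exact ⟨h2, by linarith⟩

lemma cantorMeasure_closedBall_le {R : ℝ} (hR : 2 ≤ R) (z ε : ℝ) (n : ℕ)
    (hε : 2 * ε < (R ^ n)⁻¹) :
    cantorMeasure R (Metric.closedBall z ε) ≤ ENNReal.ofReal (2 * (2 ^ n)⁻¹) := by
  have hm := (cantorMap_mono hR).measurable
  rw [cantorMeasure, Measure.map_apply hm measurableSet_closedBall,
    Measure.restrict_apply (hm measurableSet_closedBall)]
  refine (Real.volume_le_diam _).trans ?_
  have key : ∀ x ∈ cantorMap R ⁻¹' Metric.closedBall z ε ∩ Ico 0 1,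
      ∀ y ∈ cantorMap R ⁻¹' Metric.closedBall z ε ∩ Ico 0 1, y - x ≤ 2 * (2 ^ n)⁻¹ := by
    rintro x ⟨hx, hx0, -⟩ y ⟨hy, -⟩
    by_contra! h
    have := inv_pow_le_cantorMap_sub hR hx0 n (y := y) (by linarith)
    simp only [mem_preimage, Metric.mem_closedBall, Real.dist_eq, abs_le] at hx hy
    linarith
  refine Metric.ediam_le fun x hx y hy => ?_
  rw [edist_dist, Real.dist_eq]
  refine ENNReal.ofReal_le_ofReal (abs_le.2 ⟨?_, key y hy x hx⟩)
  linarith [key x hx y hy]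

lemma exists_cover_cantorMeasure {R : ℝ} (hR : 2 ≤ R) {ε : ℝ} (n : ℕ) (hε : (R ^ n)⁻¹ ≤ ε) :
    ∃ t : Finset ℝ, t.card ≤ 2 ^ n ∧
      cantorMeasure R (⋃ x ∈ t, Metric.closedBall x ε) = 1 := by
  have hR0 : 0 < R := by linarith
  refine ⟨(Finset.range (2 ^ n)).image fun m => (R ^ n)⁻¹ * digitSpread R m,
    Finset.card_image_le.trans (by simp), cantorMeasure_eq_one hR
      (Finset.measurableSet_biUnion _ fun _ _ => measurableSet_closedBall) fun x hx => ?_⟩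
  have h1 := cantorMap_le hR x n
  have h2 := le_cantorMap hR x n
  simp only [Finset.mem_image, Finset.mem_range, iUnion_exists, biUnion_and',
    iUnion_iUnion_eq_right, mem_iUnion, exists_prop]
  refine ⟨⌊2 ^ n * x⌋₊, ?_, ?_⟩
  · rw [Nat.floor_lt (mul_nonneg (by positivity) hx.1)]
    push_cast
    nlinarith [hx.2, pow_pos (two_pos (α := ℝ)) n]
  · rw [Metric.mem_closedBall, Real.dist_eq, abs_le]
    constructor <;> linarith [inv_pos.2 (pow_pos hR0 n)]

lemma two_pow_eq_rpow {R t : ℝ} (hR : 2 ≤ R) (hRt : R ^ t = 2) (n : ℕ) :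
    (2 : ℝ) ^ n = (R ^ n) ^ t := by
  have hR0 : 0 ≤ R := by linarith
  rw [← hRt, ← Real.rpow_mul_natCast hR0, mul_comm, Real.rpow_natCast_mul hR0]

/-- Existence of an Ahlfors regular measure on `[0, 1]` of any dimension `t ∈ (0, 1]`. -/
lemma exists_ahlfors_regular_real {t : ℝ} (ht0 : 0 < t) (ht1 : t ≤ 1) :
    ∃ ν : Measure ℝ, IsProbabilityMeasure ν ∧ ν (Icc 0 1) = 1 ∧
      ∃ C : ℝ, 0 < C ∧ ∀ ε : ℝ, 0 < ε → ε ≤ 1 / 4 →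
        (∀ z, ν (Metric.closedBall z ε) ≤ ENNReal.ofReal (C * ε ^ t)) ∧
        ∃ s : Finset ℝ, (s.card : ℝ) ≤ C * (ε ^ t)⁻¹ ∧
          ν (⋃ x ∈ s, Metric.closedBall x ε) = 1 := by
  set R : ℝ := 2 ^ (1 / t) with hRdef
  have hR : 2 ≤ R := by
    have : (2 : ℝ) ^ (1 : ℝ) ≤ 2 ^ (1 / t) :=
      Real.rpow_le_rpow_of_exponent_le one_le_two ((one_le_div ht0).2 ht1)
    rwa [Real.rpow_one] at this
  have hRt : R ^ t = 2 := by
    rw [hRdef, ← Real.rpow_mul (by norm_num), one_div_mul_cancel ht0.ne', Real.rpow_one]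
  have hR0 : 0 < R := by linarith
  have hR1 : R⁻¹ < 1 := inv_lt_one_of_one_lt₀ (by linarith)
  refine ⟨cantorMeasure R, isProbabilityMeasure_cantorMeasure hR, cantorMeasure_Icc hR,
    4 * 4 ^ t, by positivity, fun ε hε hε4 => ⟨fun z => ?_, ?_⟩⟩
  · obtain ⟨n, hn1, hn2⟩ := exists_nat_pow_near_of_lt_one (x := 4 * ε) (by linarith)
      (by linarith) (inv_pos.2 hR0) hR1
    rw [inv_pow] at hn1 hn2
    refine (cantorMeasure_closedBall_le hR z ε n (by linarith)).trans
      (ENNReal.ofReal_le_ofReal ?_)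
    have h : ((2 : ℝ) ^ (n + 1))⁻¹ ≤ (4 * ε) ^ t := by
      rw [two_pow_eq_rpow hR hRt, ← Real.inv_rpow (by positivity)]
      gcongr
    rw [Real.mul_rpow (by norm_num) hε.le, pow_succ, mul_inv] at h
    linarith
  · obtain ⟨n, hn1, hn2⟩ := exists_nat_pow_near_of_lt_one hε (by linarith)
      (inv_pos.2 hR0) hR1
    rw [inv_pow] at hn1 hn2
    obtain ⟨s, hs, hs1⟩ := exists_cover_cantorMeasure hR (n + 1) hn1.le
    refine ⟨s, ?_, hs1⟩
    have h : (2 : ℝ) ^ n ≤ (ε ^ t)⁻¹ := by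
      rw [two_pow_eq_rpow hR hRt, ← Real.inv_rpow hε.le]
      gcongr
      exact (le_inv_comm₀ hε (by positivity)).1 hn2
    have h4 : (1 : ℝ) ≤ 4 ^ t := Real.one_le_rpow (by norm_num) ht0.le
    calc (s.card : ℝ) ≤ 2 ^ (n + 1) := by exact_mod_cast hs
      _ = 2 * 2 ^ n := by ring
      _ ≤ 2 * (ε ^ t)⁻¹ := by gcongr
      _ ≤ 4 * 4 ^ t * (ε ^ t)⁻¹ := by gcongr; linarith

/-- Existence of an Ahlfors regular measure on `[0, 1]^d` of any dimension `D ∈ (0, d]`. -/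
lemma exists_ahlfors_regular_pi {d : ℕ} {D : ℝ} (hD0 : 0 < D) (hDd : D ≤ d) :
    ∃ μ : Measure (Fin d → ℝ), IsProbabilityMeasure μ ∧ μ (Icc 0 1) = 1 ∧
      ∃ C : ℝ, 0 < C ∧ ∀ ε : ℝ, 0 < ε → ε ≤ 1 / 4 →
        (∀ z, μ (Metric.closedBall z ε) ≤ ENNReal.ofReal (C * ε ^ D)) ∧
        ∃ s : Finset (Fin d → ℝ), (s.card : ℝ) ≤ C * (ε ^ D)⁻¹ ∧
          μ (⋃ x ∈ s, Metric.closedBall x ε) = 1 := by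
  have hd : (0 : ℝ) < d := hD0.trans_le hDd
  obtain ⟨ν, hν, hν1, C, hC, H⟩ := exists_ahlfors_regular_real (t := D / d) (by positivity)
    ((div_le_one hd).2 hDd)
  have hpow : ∀ ε : ℝ, 0 < ε → (ε ^ (D / d)) ^ d = ε ^ D := fun ε hε => by
    rw [← Real.rpow_mul_natCast hε.le, div_mul_cancel₀ _ hd.ne']
  refine ⟨Measure.pi fun _ => ν, inferInstance, ?_, C ^ d, by positivity,
    fun ε hε hε4 => ⟨fun z => ?_, ?_⟩⟩
  · rw [← pi_univ_Icc, Measure.pi_pi]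
    simp [hν1]
  · rw [Measure.pi_closedBall _ _ hε.le]
    calc ∏ i, ν (Metric.closedBall (z i) ε)
        ≤ ∏ _i : Fin d, ENNReal.ofReal (C * ε ^ (D / d)) :=
          Finset.prod_le_prod' fun i _ => (H ε hε hε4).1 (z i)
      _ = ENNReal.ofReal (C ^ d * ε ^ D) := by
          rw [Finset.prod_const, Finset.card_univ, Fintype.card_fin,
            ← ENNReal.ofReal_pow (by positivity), mul_pow, hpow ε hε]
  · obtain ⟨s, hs, hs1⟩ := (H ε hε hε4).2
    refine ⟨Fintype.piFinset fun _ => s, ?_, ?_⟩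
    · rw [Fintype.card_piFinset_const, Nat.cast_pow, ← hpow ε hε, ← inv_pow, ← mul_pow]
      gcongr
    · refine le_antisymm prob_le_one ?_
      have : (Measure.pi fun _ : Fin d => ν)
          (univ.pi fun _ => ⋃ x ∈ s, Metric.closedBall x ε) = 1 := by
        rw [Measure.pi_pi]; simp [hs1]
      rw [← this]
      refine measure_mono fun x hx => ?_
      simp only [Set.mem_pi, mem_univ, true_imp_iff, mem_iUnion, exists_prop] at hx ⊢
      choose p hp hxp using hx
      refine ⟨p, by simpa using hp, ?_⟩
      rw [closedBall_pi _ hε.le]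
      exact fun i _ => hxp i

section Regular

variable {X : Type*} [PseudoMetricSpace X] [MeasurableSpace X] [OpensMeasurableSpace X]

lemma exists_measCoverN_eq {μ : Measure X} {ε τ C v : ℝ} (hC : 0 < C) (hv : 0 < v)
    (hτ0 : 0 ≤ τ) (hτ : τ ≤ 1 / 2)
    (hball : ∀ z, μ (Metric.closedBall z ε) ≤ ENNReal.ofReal (C * v))
    (hcover : ∃ s : Finset X, (s.card : ℝ) ≤ C * v⁻¹ ∧
      μ (⋃ x ∈ s, Metric.closedBall x ε) = 1) :
    ∃ k : ℕ, measCoverN μ ε τ = k ∧ (2 * C)⁻¹ * v⁻¹ ≤ k ∧ (k : ℝ) ≤ C * v⁻¹ := by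
  obtain ⟨s, hs, hs1⟩ := hcover
  have hle : measCoverN μ ε τ ≤ s.card := by
    refine iInf_le_of_le (⋃ x ∈ s, Metric.closedBall x ε) (iInf_le_of_le
      (Finset.measurableSet_biUnion _ fun _ _ => measurableSet_closedBall)
      (iInf_le_of_le ?_ (iInf_le_of_le s (iInf_le_of_le subset_rfl le_rfl))))
    rw [hs1]
    exact ENNReal.ofReal_le_one.2 (by linarith)
  have hge : ((⌈(2 * C)⁻¹ * v⁻¹⌉₊ : ℕ) : ℕ∞) ≤ measCoverN μ ε τ := by
    refine le_iInf fun S => le_iInf fun _ => le_iInf fun hS => le_iInf fun t =>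
      le_iInf fun hSt => Nat.cast_le.2 (Nat.ceil_le.2 ?_)
    have h : ENNReal.ofReal (1 - τ) ≤ ENNReal.ofReal (t.card * (C * v)) :=
      calc ENNReal.ofReal (1 - τ) ≤ μ S := hS
        _ ≤ μ (⋃ x ∈ t, Metric.closedBall x ε) := measure_mono hSt
        _ ≤ ∑ x ∈ t, μ (Metric.closedBall x ε) := measure_biUnion_finset_le _ _
        _ ≤ ∑ _x ∈ t, ENNReal.ofReal (C * v) := Finset.sum_le_sum fun x _ => hball x
        _ = ENNReal.ofReal (t.card * (C * v)) := by
          rw [Finset.sum_const, nsmul_eq_mul, ENNReal.ofReal_mul (Nat.cast_nonneg _),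
            ENNReal.ofReal_natCast]
    have h' := (ENNReal.ofReal_le_ofReal_iff (by positivity)).1 h
    rw [← mul_inv, inv_le_iff_one_le_mul₀ (by positivity)]
    linarith
  obtain ⟨k, hk⟩ := ENat.ne_top_iff_exists.1 (ne_top_of_le_ne_top (ENat.natCast_ne_top _) hle)
  rw [← hk] at hle hge
  exact ⟨k, hk.symm, Nat.ceil_le.1 (Nat.cast_le.1 hge),
    (Nat.cast_le.2 (Nat.cast_le.1 hle)).trans hs⟩

lemma dimRatio_natCast {k : ℕ} (hk : 0 < k) (ε : ℝ) :
    dimRatio k ε = ((Real.log k / Real.log (1 / ε) : ℝ) : EReal) := by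
  have h : elog ((k : ℕ∞) : ℝ≥0∞) = ((Real.log k : ℝ) : EReal) := by
    simp [elog, hk.ne']
  rw [dimRatio, h, ← EReal.coe_mul, ← div_eq_mul_inv]

lemma tendsto_dimRatio_measCoverN {μ : Measure X} {C D : ℝ} (hC : 0 < C)
    (H : ∀ ε : ℝ, 0 < ε → ε ≤ 1 / 4 →
      (∀ z, μ (Metric.closedBall z ε) ≤ ENNReal.ofReal (C * ε ^ D)) ∧
      ∃ s : Finset X, (s.card : ℝ) ≤ C * (ε ^ D)⁻¹ ∧
        μ (⋃ x ∈ s, Metric.closedBall x ε) = 1)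
    {τ : ℝ → ℝ} (hτ : ∀ᶠ ε in 𝓝[>] (0 : ℝ), 0 ≤ τ ε ∧ τ ε ≤ 1 / 2) :
    Tendsto (fun ε => dimRatio (measCoverN μ ε (τ ε)) ε) (𝓝[>] (0 : ℝ)) (𝓝 (D : EReal)) := by
  have hL : Tendsto (fun ε : ℝ => Real.log (1 / ε)) (𝓝[>] (0 : ℝ)) atTop := by
    simp only [one_div]
    exact Real.tendsto_log_atTop.comp tendsto_inv_nhdsGT_zero
  have hlim : ∀ c : ℝ, Tendsto (fun ε : ℝ => (((c / Real.log (1 / ε) + D : ℝ)) : EReal))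
      (𝓝[>] (0 : ℝ)) (𝓝 (D : EReal)) := fun c => by
    refine (continuous_coe_real_ereal.tendsto D).comp ?_
    simpa using (hL.const_div_atTop c).add_const D
  have hsmall : ∀ᶠ ε in 𝓝[>] (0 : ℝ), ε ∈ Ioc (0 : ℝ) (1 / 4) :=
    Ioc_mem_nhdsGT (by norm_num)
  have key : ∀ᶠ ε in 𝓝[>] (0 : ℝ),
      (((Real.log (2 * C)⁻¹ / Real.log (1 / ε) + D : ℝ)) : EReal) ≤
        dimRatio (measCoverN μ ε (τ ε)) ε ∧ dimRatio (measCoverN μ ε (τ ε)) ε ≤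
        (((Real.log C / Real.log (1 / ε) + D : ℝ)) : EReal) := by
    filter_upwards [hsmall, hτ] with ε ⟨hε, hε4⟩ ⟨hτ0, hτ1⟩
    have hv : 0 < ε ^ D := by positivity
    obtain ⟨k, hk, hk1, hk2⟩ := exists_measCoverN_eq hC hv hτ0 hτ1 (H ε hε hε4).1
      (H ε hε hε4).2
    have hk0 : (0 : ℝ) < k := lt_of_lt_of_le (by positivity) hk1
    have hl : 0 < Real.log (1 / ε) := Real.log_pos (by rw [lt_div_iff₀ hε]; linarith)
    have hlog : ∀ c : ℝ, 0 < c →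
        c.log / Real.log (1 / ε) + D = Real.log (c * (ε ^ D)⁻¹) / Real.log (1 / ε) := by
      intro c hc
      rw [Real.log_mul hc.ne' (by positivity), ← Real.inv_rpow hε.le,
        Real.log_rpow (by positivity), ← one_div, add_div, mul_div_cancel_right₀ _ hl.ne']
    rw [hk, dimRatio_natCast (Nat.cast_pos.1 hk0), hlog _ (by positivity), hlog _ hC,
      EReal.coe_le_coe_iff, EReal.coe_le_coe_iff]
    constructor <;> gcongr
  exact tendsto_of_tendsto_of_tendsto_of_le_of_le' (hlim _) (hlim _)
    (key.mono fun _ h => h.1) (key.mono fun _ h => h.2)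

end Regular

/-- Let `β > 0` and `d ≥ 2β`.  For every real `d⋆ ∈ [2β, d]` there exists a
Borel probability measure `μ⋆` on `[0,1]^d` with `d*_β(μ⋆) = d_*(μ⋆) = d⋆`. -/
theorem exists_measure_upperWDim_eq_lowerWDim
    (d : ℕ) (β : ℝ) (hβ : 0 < β) (hd : 2 * β ≤ (d : ℝ))
    (dstar : ℝ) (h1 : 2 * β ≤ dstar) (h2 : dstar ≤ (d : ℝ)) :
    ∃ μ : Measure (Fin d → ℝ), IsProbabilityMeasure μ ∧ μ (Set.Icc 0 1) = 1 ∧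
      upperWDim μ β = (dstar : EReal) ∧ lowerWDim μ = (dstar : EReal) := by
  have hD : 0 < dstar := by linarith
  obtain ⟨μ, hμ, hμ1, C, hC, H⟩ := exists_ahlfors_regular_pi hD h2
  have hτ : ∀ s : ℝ, 2 * β < s →
      limsup (fun ε : ℝ => dimRatio (measCoverN μ ε (ε ^ (s * β / (s - 2 * β)))) ε)
        (𝓝[>] (0 : ℝ)) = (dstar : EReal) := by
    intro s hs
    refine (tendsto_dimRatio_measCoverN hC H ?_).limsup_eq
    have he : 0 < s * β / (s - 2 * β) :=
      div_pos (mul_pos (by linarith) hβ) (by linarith)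
    have ht : Tendsto (fun ε : ℝ => ε ^ (s * β / (s - 2 * β))) (𝓝[>] (0 : ℝ)) (𝓝 0) := by
      have := (Real.continuous_rpow_const he.le).tendsto 0
      rw [Real.zero_rpow he.ne'] at this
      exact this.mono_left nhdsWithin_le_nhds
    filter_upwards [self_mem_nhdsWithin,
      ht.eventually_le_const (show (0 : ℝ) < 1 / 2 by norm_num)] with ε hε hle
    exact ⟨Real.rpow_nonneg (le_of_lt hε) _, hle⟩
  refine ⟨μ, hμ, hμ1, le_antisymm ?_ ?_, ?_⟩
  · refine EReal.le_of_forall_lt_iff_le.1 fun s hs => ?_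
    have hs' : dstar < s := EReal.coe_lt_coe_iff.1 hs
    exact sInf_le ⟨s, rfl, by linarith, (hτ s (by linarith)).trans_le hs.le⟩
  · refine le_sInf ?_
    rintro _ ⟨s, rfl, hs, hle⟩
    rwa [hτ s hs] at hle
  · have : ∀ᶠ τ in 𝓝[>] (0 : ℝ),
        liminf (fun ε : ℝ => dimRatio (measCoverN μ ε τ) ε) (𝓝[>] (0 : ℝ)) =
          (dstar : EReal) := by
      filter_upwards [Ioc_mem_nhdsGT (show (0 : ℝ) < 1 / 2 by norm_num)] with τ hτ'
      exact (tendsto_dimRatio_measCoverN hC H (τ := fun _ => τ)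
        (Eventually.of_forall fun _ => ⟨hτ'.1.le, hτ'.2⟩)).liminf_eq
    rw [lowerWDim, limsup_congr this, limsup_const]
end
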